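/- Let m, p, r be positive integers with p dividing m. Then Ψ_{m−p}(APS(p, 2r+1) ∖ APS(p, p, 2r+1)) = APS(m, 2r+1) ∖ APS(m, p, 2r+1), where Ψ_{m−p} is applied to each member of the collection. -/

import Mathlib

open Finset

/-- `Prec p q` means the colored symbol `p = ξ^{p.1}(p.2)` precedes (is smaller than)
`q = ξ^{q.1}(q.2)`: `a > b`, or (`a = b` and `x > y`). -/
def Prec (p q : ℕ × ℕ) : Prop :=
  q.1 < p.1 ∨ (p.1 = q.1 ∧ q.2 < p.2)

instance : DecidableRel Prec := fun p q => by
  unfold Prec; infer_instance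

/-- `w : ℕ → ℕ × ℕ` (read on positions `1,…,n`) is an element of `Z_m ≀ S_n`:
each entry has color `< m` and norm in `{1,…,n}`, and the norms are pairwise distinct. -/
def IsGenPerm (m n : ℕ) (w : ℕ → ℕ × ℕ) : Prop :=
  (∀ i ∈ Finset.Icc 1 n, (w i).1 < m ∧ (w i).2 ∈ Finset.Icc 1 n) ∧
    Set.InjOn (fun i => (w i).2) (Set.Icc 1 n)

/-- The pinnacle set of the word `w`: values at interior positions `2 ≤ i ≤ n-1`
that strictly dominate both neighbors. -/
def pin (n : ℕ) (w : ℕ → ℕ × ℕ) : Finset (ℕ × ℕ) :=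
  ((Finset.Icc 2 (n - 1)).filter
      (fun i => Prec (w (i - 1)) (w i) ∧ Prec (w (i + 1)) (w i))).image w

/-- `P` is an admissible pinnacle set for `Z_m ≀ S_n`. -/
def IsAdmissible (m n : ℕ) (P : Finset (ℕ × ℕ)) : Prop :=
  ∃ w, IsGenPerm m n w ∧ pin n w = P

/-- `APS m n d` : admissible pinnacle sets for `Z_m ≀ S_n` of cardinality at most `d`. -/
def APS (m n d : ℕ) : Set (Finset (ℕ × ℕ)) :=
  {P | IsAdmissible m n P ∧ P.card ≤ d}

/-- `Ψ_k` : increase every color by `k`, keeping norms. -/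
def PsiSet (k : ℕ) (P : Finset (ℕ × ℕ)) : Finset (ℕ × ℕ) :=
  P.image (fun p => (p.1 + k, p.2))

/-- `ψ_k` : increase the color of every entry of the word by `k`. -/
def psiWord (k : ℕ) (w : ℕ → ℕ × ℕ) : ℕ → ℕ × ℕ :=
  fun i => ((w i).1 + k, (w i).2)

/-- The color sum `ε_w = e_1 + ⋯ + e_n` of a word `w`. -/
def epsSum (n : ℕ) (w : ℕ → ℕ × ℕ) : ℕ :=
  ∑ i ∈ Finset.Icc 1 n, (w i).1

/-- `APSc m p n d` : sets `P` with `#P ≤ d` admitting a witness in the complex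
reflection group `G(m,p,n) = {w ∈ Z_m ≀ S_n : ε_w ≡ 0 (mod p)}`. -/
def APSc (m p n d : ℕ) : Set (Finset (ℕ × ℕ)) :=
  {P | (∃ w, IsGenPerm m n w ∧ p ∣ epsSum n w ∧ pin n w = P) ∧ P.card ≤ d}

theorem Prec.trans {a b c : ℕ × ℕ} (hab : Prec a b) (hbc : Prec b c) : Prec a c := by
  unfold Prec at *; omega

theorem Prec.not_symm {a b : ℕ × ℕ} (hab : Prec a b) : ¬ Prec b a := by
  unfold Prec at *; omega

theorem Prec.ne {a b : ℕ × ℕ} (hab : Prec a b) : a ≠ b := by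
  rintro rfl; exact hab.not_symm hab

/-- Every finite set of symbols can be listed in increasing order. -/
theorem exists_prec_enumeration (P : Finset (ℕ × ℕ)) :
    ∃ q : ℕ → ℕ × ℕ, (∀ i j, i < j → j < P.card → Prec (q i) (q j)) ∧
      (Finset.range P.card).image q = P := by
  let e : ℕ × ℕ → (ℕ ×ₗ ℕ)ᵒᵈ := fun x => OrderDual.toDual (toLex x)
  have he : Function.Injective e := fun _ _ h => h
  have hc : (P.image e).card = P.card := Finset.card_image_of_injective _ he
  let f := (P.image e).orderEmbOfFin hc
  let q : ℕ → ℕ × ℕ := fun i =>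
    if h : i < P.card then ofLex (OrderDual.ofDual (f ⟨i, h⟩)) else (0, 0)
  refine ⟨q, ?_, ?_⟩
  · intro i j hij hj
    have h : f ⟨i, hij.trans hj⟩ < f ⟨j, hj⟩ := f.strictMono hij
    have h2 := Prod.Lex.lt_iff.mp (OrderDual.ofDual_lt_ofDual.mpr h)
    simp only [q, hj, hij.trans hj, dif_pos, Prec]
    rcases h2 with h2 | h2
    · exact Or.inl h2
    · exact Or.inr ⟨h2.1.symm, h2.2⟩
  · have hmem : ∀ i (h : i < P.card), q i ∈ P := by
      intro i h
      obtain ⟨x, hx, hxe⟩ := Finset.mem_image.mp ((P.image e).orderEmbOfFin_mem hc ⟨i, h⟩)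
      have : q i = x := by
        simp only [q, h, dif_pos, f]
        rw [← hxe]; rfl
      rwa [this]
    ext x
    simp only [Finset.mem_image, Finset.mem_range]
    constructor
    · rintro ⟨i, hi, rfl⟩
      exact hmem i hi
    · intro hx
      have : e x ∈ Set.range f := by
        rw [Finset.range_orderEmbOfFin]
        exact Finset.mem_coe.mpr (Finset.mem_image_of_mem e hx)
      obtain ⟨i, hi⟩ := this
      refine ⟨i, i.2, ?_⟩
      simp only [q, i.2, dif_pos]
      rw [Fin.eta, hi]; rfl

/-- The positions of the pinnacles of `w`. -/
def pinPos (n : ℕ) (w : ℕ → ℕ × ℕ) : Finset ℕ :=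
  (Finset.Icc 2 (n - 1)).filter (fun i => Prec (w (i - 1)) (w i) ∧ Prec (w (i + 1)) (w i))

theorem pin_eq_image_pinPos (n : ℕ) (w : ℕ → ℕ × ℕ) : pin n w = (pinPos n w).image w := rfl

theorem mem_pinPos {n : ℕ} {w : ℕ → ℕ × ℕ} {j : ℕ} :
    j ∈ pinPos n w ↔
      (2 ≤ j ∧ j ≤ n - 1) ∧ Prec (w (j - 1)) (w j) ∧ Prec (w (j + 1)) (w j) := by
  simp [pinPos]

theorem succ_notMem_pinPos {n : ℕ} {w : ℕ → ℕ × ℕ} {j : ℕ} (hj : j ∈ pinPos n w) :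
    j + 1 ∉ pinPos n w := fun h =>
  (mem_pinPos.mp h).2.1.not_symm (mem_pinPos.mp hj).2.2

theorem pred_notMem_pinPos {n : ℕ} {w : ℕ → ℕ × ℕ} {j : ℕ} (hj : j ∈ pinPos n w) :
    j - 1 ∉ pinPos n w := fun h => by
  have h1 := mem_pinPos.mp hj
  have h2 := succ_notMem_pinPos h
  rw [Nat.sub_add_cancel (by omega)] at h2
  exact h2 hj

theorem IsGenPerm.card_pinPos {m n : ℕ} {w : ℕ → ℕ × ℕ} (hw : IsGenPerm m n w) :
    (pinPos n w).card = (pin n w).card := by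
  rw [pin_eq_image_pinPos, Finset.card_image_of_injOn]
  intro i hi j hj hij
  have hi := mem_pinPos.mp hi
  have hj := mem_pinPos.mp hj
  exact hw.2 ⟨by omega, by omega⟩ ⟨by omega, by omega⟩ (congrArg Prod.snd hij)

/-- The symbols of the least possible order (color `m - 1`) whose norms do not occur in `P`. -/
def freeSymbols (m n : ℕ) (P : Finset (ℕ × ℕ)) : Finset (ℕ × ℕ) :=
  (Finset.Icc 1 n \ P.image Prod.snd).image (fun x => (m - 1, x))

theorem mem_freeSymbols {m n : ℕ} {P : Finset (ℕ × ℕ)} {x : ℕ × ℕ} :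
    x ∈ freeSymbols m n P ↔
      x.1 = m - 1 ∧ (1 ≤ x.2 ∧ x.2 ≤ n) ∧ ∀ y ∈ P, y.2 ≠ x.2 := by
  obtain ⟨a, b⟩ := x
  simp only [freeSymbols, Finset.mem_image, Finset.mem_sdiff, Finset.mem_Icc, Prod.mk.injEq]
  constructor
  · rintro ⟨c, ⟨h1, h2⟩, rfl, rfl⟩
    exact ⟨rfl, h1, fun y hy hyc => h2 ⟨y, hy, hyc⟩⟩
  · rintro ⟨rfl, h1, h2⟩
    exact ⟨b, ⟨h1, fun ⟨y, hy, hyc⟩ => h2 y hy hyc⟩, rfl, rfl⟩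

theorem IsGenPerm.bounds {m n : ℕ} {w : ℕ → ℕ × ℕ} (hw : IsGenPerm m n w) {j : ℕ}
    (h1 : 1 ≤ j) (hn : j ≤ n) : (w j).1 < m ∧ 1 ≤ (w j).2 ∧ (w j).2 ≤ n := by
  simpa using hw.1 j (Finset.mem_Icc.mpr ⟨h1, hn⟩)

theorem IsGenPerm.bounds_of_mem_pin {m n : ℕ} {w : ℕ → ℕ × ℕ} (hw : IsGenPerm m n w)
    {x : ℕ × ℕ} (hx : x ∈ pin n w) : x.1 < m ∧ 1 ≤ x.2 ∧ x.2 ≤ n := by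
  rw [pin_eq_image_pinPos] at hx
  obtain ⟨j, hj, rfl⟩ := Finset.mem_image.mp hx
  have := (mem_pinPos.mp hj).1
  exact hw.bounds (by omega) (by omega)

theorem IsGenPerm.injOn_norm_pin {m n : ℕ} {w : ℕ → ℕ × ℕ} (hw : IsGenPerm m n w) :
    Set.InjOn Prod.snd (pin n w : Set (ℕ × ℕ)) := by
  intro x hx y hy hxy
  obtain ⟨i, hi, rfl⟩ := Finset.mem_image.mp (Finset.mem_coe.mp hx)
  obtain ⟨j, hj, rfl⟩ := Finset.mem_image.mp (Finset.mem_coe.mp hy)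
  have hi := (mem_pinPos.mp hi).1
  have hj := (mem_pinPos.mp hj).1
  rw [hw.2 ⟨by omega, by omega⟩ ⟨by omega, by omega⟩ hxy]

theorem IsGenPerm.card_freeSymbols {m n : ℕ} {w : ℕ → ℕ × ℕ} (hw : IsGenPerm m n w) :
    (freeSymbols m n (pin n w)).card = n - (pin n w).card := by
  rw [freeSymbols, Finset.card_image_of_injective _ (fun a b h => (Prod.mk.inj h).2),
    Finset.card_sdiff_of_subset, Finset.card_image_of_injOn hw.injOn_norm_pin, Nat.card_Icc]
  · omega
  · intro x hx
    obtain ⟨y, hy, rfl⟩ := Finset.mem_image.mp hx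
    exact Finset.mem_Icc.mpr (hw.bounds_of_mem_pin hy).2

/-- If `t` dominates the pinnacles at the positions `S`, then more than `#S` free symbols
lie below `t`. -/
theorem IsGenPerm.card_lt_card_free_below {m n : ℕ} {w : ℕ → ℕ × ℕ} (hw : IsGenPerm m n w)
    {t : ℕ × ℕ} {S : Finset ℕ} (hS : S.Nonempty) (hSp : S ⊆ pinPos n w)
    (hSt : ∀ j ∈ S, w j = t ∨ Prec (w j) t) :
    S.card < ((freeSymbols m n (pin n w)).filter (fun x => Prec x t)).card := by
  have hmin := S.min'_mem hS
  have hcard : (insert (S.min' hS - 1) (S.image (· + 1))).card = S.card + 1 := by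
    rw [Finset.card_insert_of_notMem, Finset.card_image_of_injective _ (add_left_injective 1)]
    intro h
    obtain ⟨j, hj, hj'⟩ := Finset.mem_image.mp h
    have := S.min'_le j hj
    omega
  have hT : ∀ j ∈ insert (S.min' hS - 1) (S.image (· + 1)),
      (1 ≤ j ∧ j ≤ n) ∧ j ∉ pinPos n w ∧ Prec (w j) t := by
    have below : ∀ a s, s ∈ S → Prec a (w s) → Prec a t := by
      intro a s hs h
      rcases hSt s hs with h' | h'
      · exact h' ▸ h
      · exact h.trans h'
    intro j hj
    rcases Finset.mem_insert.mp hj with rfl | hj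
    · have h := mem_pinPos.mp (hSp hmin)
      exact ⟨by omega, pred_notMem_pinPos (hSp hmin), below _ _ hmin h.2.1⟩
    · obtain ⟨s, hs, rfl⟩ := Finset.mem_image.mp hj
      have h := mem_pinPos.mp (hSp hs)
      exact ⟨by omega, succ_notMem_pinPos (hSp hs), below _ _ hs h.2.2⟩
  rw [← Nat.succ_le_iff, Nat.succ_eq_add_one, ← hcard]
  refine Finset.card_le_card_of_injOn (fun j => (m - 1, (w j).2)) ?_ ?_
  · intro j hj
    obtain ⟨hj1, hjp, hjt⟩ := hT j hj
    have hb := hw.bounds hj1.1 hj1.2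
    refine Finset.mem_coe.mpr (Finset.mem_filter.mpr ⟨mem_freeSymbols.mpr ⟨rfl, hb.2, ?_⟩, ?_⟩)
    · intro y hy hyj
      obtain ⟨i, hi, rfl⟩ := Finset.mem_image.mp hy
      have hi' := (mem_pinPos.mp hi).1
      have : i = j := hw.2 ⟨by omega, by omega⟩ hj1 hyj
      exact hjp (this ▸ hi)
    · unfold Prec at *
      simp only
      omega
  · intro i hi j hj hij
    exact hw.2 (hT i hi).1 (hT j hj).1 (Prod.mk.inj hij).2

/-- Pinnacles `q` and free symbols `u` alternate, starting and ending with `u`; the remaining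
free symbols follow, and the last entry gets the color `c`. -/
def zigzag (n d c : ℕ) (q u : ℕ → ℕ × ℕ) (j : ℕ) : ℕ × ℕ :=
  if j = n then (c, (u (n - d - 1)).2)
  else if j ≤ 2 * d + 1 then
    if j % 2 = 0 then q (j / 2 - 1) else u (j / 2)
  else u (j - d - 1)

section zigzag

variable {m n d c : ℕ} {q u : ℕ → ℕ × ℕ}

theorem zigzag_even {i : ℕ} (hdn : 2 * d + 1 ≤ n) (hi : i < d) :
    zigzag n d c q u (2 * (i + 1)) = q i := by
  unfold zigzag
  rw [if_neg (by omega), if_pos (by omega), if_pos (by omega)]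
  congr 1; omega

/-- An odd position, or one behind the alternating part, shows the norm of a free symbol. -/
theorem zigzag_free {j : ℕ} (hdn : 2 * d + 1 ≤ n) (h1 : 1 ≤ j) (hj : j ≤ n)
    (hf : j % 2 = 1 ∨ 2 * d + 1 < j) :
    ∃ i < n - d, i = (if j ≤ 2 * d + 1 then j / 2 else j - d - 1) ∧
      zigzag n d c q u j = (if j = n then (c, (u i).2) else u i) := by
  refine ⟨_, ?_, rfl, ?_⟩
  · split_ifs <;> omega
  · unfold zigzag
    by_cases hjn : j = n
    · rw [if_pos hjn, if_pos hjn]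
      have : n - d - 1 = (if j ≤ 2 * d + 1 then j / 2 else j - d - 1) := by
        split_ifs <;> omega
      rw [this]
    · rw [if_neg hjn, if_neg hjn]
      split_ifs <;> first | rfl | omega

theorem isGenPerm_zigzag (hdn : 2 * d + 1 ≤ n) (hc : c < m)
    (hq : ∀ i < d, (q i).1 < m ∧ 1 ≤ (q i).2 ∧ (q i).2 ≤ n)
    (hu : ∀ i < n - d, (u i).1 < m ∧ 1 ≤ (u i).2 ∧ (u i).2 ≤ n)
    (hqq : ∀ i < d, ∀ j < d, (q i).2 = (q j).2 → i = j)
    (huu : ∀ i < n - d, ∀ j < n - d, (u i).2 = (u j).2 → i = j)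
    (hqu : ∀ i < d, ∀ j < n - d, (q i).2 ≠ (u j).2) :
    IsGenPerm m n (zigzag n d c q u) := by
  have key : ∀ j, 1 ≤ j → j ≤ n →
      (∃ i < d, j = 2 * (i + 1) ∧ zigzag n d c q u j = q i) ∨
      (∃ i < n - d, (j % 2 = 1 ∨ 2 * d + 1 < j) ∧
        i = (if j ≤ 2 * d + 1 then j / 2 else j - d - 1) ∧
        (zigzag n d c q u j).1 < m ∧ (zigzag n d c q u j).2 = (u i).2) := by
    intro j h1 hj
    by_cases hf : j % 2 = 1 ∨ 2 * d + 1 < j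
    · obtain ⟨i, hi, hi2, hz⟩ := zigzag_free (c := c) (q := q) (u := u) hdn h1 hj hf
      refine Or.inr ⟨i, hi, hf, hi2, ?_⟩
      rw [hz]
      split_ifs
      · exact ⟨hc, rfl⟩
      · exact ⟨(hu i hi).1, rfl⟩
    · have hj2 : j = 2 * ((j / 2 - 1) + 1) := by omega
      refine Or.inl ⟨j / 2 - 1, by omega, hj2, ?_⟩
      conv_lhs => rw [hj2]
      exact zigzag_even hdn (by omega)
  constructor
  · intro j hj
    rw [Finset.mem_Icc] at hj
    rw [Finset.mem_Icc]
    rcases key j hj.1 hj.2 with ⟨i, hi, -, hz⟩ | ⟨i, hi, -, -, hz1, hz2⟩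
    · rw [hz]; exact hq i hi
    · rw [hz2]; exact ⟨hz1, (hu i hi).2⟩
  · intro j hj k hk hjk
    simp only at hjk
    rcases key j hj.1 hj.2 with ⟨a, ha, haj, hza⟩ | ⟨a, ha, haf, haj, -, hza⟩ <;>
    rcases key k hk.1 hk.2 with ⟨b, hb, hbk, hzb⟩ | ⟨b, hb, hbf, hbk, -, hzb⟩ <;>
    rw [hza, hzb] at hjk
    · have := hqq a ha b hb hjk
      omega
    · exact absurd hjk (hqu a ha b hb)
    · exact absurd hjk.symm (hqu b hb a ha)
    · have := huu a ha b hb hjk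
      split_ifs at haj hbk <;> omega

theorem pin_zigzag (hdn : 2 * d + 1 ≤ n) (hc : c < m)
    (hu : ∀ i < n - d, (u i).1 = m - 1)
    (humono : ∀ i j, i < j → j < n - d → Prec (u i) (u j))
    (huq : ∀ i < d, Prec (u (i + 1)) (q i))
    (hlast : n = 2 * d + 1 → ∀ i, i + 1 = d → Prec (c, (u (i + 1)).2) (q i)) :
    pin n (zigzag n d c q u) = (Finset.range d).image q := by
  have left : ∀ i < d, Prec (zigzag n d c q u (2 * i + 1)) (q i) := by
    intro i hi
    have : zigzag n d c q u (2 * i + 1) = u i := by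
      unfold zigzag
      rw [if_neg (by omega), if_pos (by omega), if_neg (by omega)]
      congr 1; omega
    rw [this]
    exact (humono i (i + 1) (by omega) (by omega)).trans (huq i hi)
  have right : ∀ i < d, Prec (zigzag n d c q u (2 * i + 3)) (q i) := by
    intro i hi
    obtain ⟨k, -, hk, hz⟩ := zigzag_free (c := c) (q := q) (u := u) (j := 2 * i + 3) hdn
      (by omega) (by omega) (by omega)
    rw [if_pos (by omega)] at hk
    obtain rfl : k = i + 1 := by omega
    rw [hz]
    split_ifs with h
    · exact hlast (by omega) i (by omega)
    · exact huq i hi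
  have tail : ∀ j, 2 * d + 1 < j → j < n →
      Prec (zigzag n d c q u j) (zigzag n d c q u (j + 1)) := by
    intro j hj hjn
    obtain ⟨a, ha, haj, hza⟩ := zigzag_free (c := c) (q := q) (u := u) (j := j) hdn
      (by omega) (by omega) (by omega)
    obtain ⟨b, hb, hbj, hzb⟩ := zigzag_free (c := c) (q := q) (u := u) (j := j + 1) hdn
      (by omega) (by omega) (by omega)
    rw [if_neg (by omega)] at haj hbj
    rw [hza, hzb, if_neg (by omega)]
    have hab := humono a b (by omega) hb
    have hau := hu a ha
    have hbu := hu b hb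
    split_ifs
    · unfold Prec at *
      simp only
      omega
    · exact hab
  have hpos : ∀ j, j ∈ pinPos n (zigzag n d c q u) ↔ ∃ i < d, j = 2 * (i + 1) := by
    intro j
    rw [mem_pinPos]
    constructor
    · rintro ⟨hj, h1, h2⟩
      by_cases hjd : 2 * d + 1 < j
      · exact absurd h2 (tail j hjd (by omega)).not_symm
      by_cases hodd : j % 2 = 1
      · have h3 := right (j / 2 - 1) (by omega)
        rw [← zigzag_even (c := c) (q := q) (u := u) hdn (show j / 2 - 1 < d by omega),
          show 2 * (j / 2 - 1) + 3 = j by omega,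
          show 2 * (j / 2 - 1 + 1) = j - 1 by omega] at h3
        exact absurd h1 h3.not_symm
      · exact ⟨j / 2 - 1, by omega, by omega⟩
    · rintro ⟨i, hi, rfl⟩
      rw [zigzag_even hdn hi]
      exact ⟨by omega, left i hi, right i hi⟩
  rw [pin_eq_image_pinPos]
  ext x
  simp only [Finset.mem_image, hpos, Finset.mem_range]
  constructor
  · rintro ⟨_, ⟨i, hi, rfl⟩, rfl⟩
    exact ⟨i, hi, (zigzag_even hdn hi).symm⟩
  · rintro ⟨i, hi, rfl⟩
    exact ⟨_, ⟨i, hi, rfl⟩, zigzag_even hdn hi⟩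

theorem epsSum_zigzag (hn : 1 ≤ n) :
    epsSum n (zigzag n d c q u) = epsSum n (zigzag n d 0 q u) + c := by
  obtain ⟨k, rfl⟩ : ∃ k, n = k + 1 := ⟨n - 1, by omega⟩
  unfold epsSum
  rw [Finset.sum_Icc_succ_top (by omega), Finset.sum_Icc_succ_top (by omega)]
  have : ∑ i ∈ Finset.Icc 1 k, (zigzag (k + 1) d c q u i).1 =
      ∑ i ∈ Finset.Icc 1 k, (zigzag (k + 1) d 0 q u i).1 := by
    refine Finset.sum_congr rfl fun i hi => ?_
    rw [Finset.mem_Icc] at hi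
    have hik : i ≠ k + 1 := by omega
    simp only [zigzag, if_neg hik]
  rw [this]
  simp [zigzag]

end zigzag

/-- Every residue class modulo `p` is represented among the `p` largest colors. -/
theorem exists_color_dvd_add {m p : ℕ} (hp : 1 ≤ p) (hpm : p ≤ m) (s : ℕ) :
    ∃ c, m - p ≤ c ∧ c < m ∧ p ∣ s + c := by
  have hlt := Nat.mod_lt (s + (m - p)) hp
  have hdm := Nat.div_add_mod (s + (m - p)) p
  by_cases h0 : (s + (m - p)) % p = 0
  · exact ⟨m - p, le_rfl, by omega, Nat.dvd_of_mod_eq_zero h0⟩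
  · refine ⟨m - (s + (m - p)) % p, by omega, by omega, (s + (m - p)) / p + 1, ?_⟩
    rw [mul_add, mul_one]
    omega

/-- An admissible pinnacle set has a witness of color sum divisible by `p` as soon as it is not
of maximal size or contains a pinnacle that is not of one of the `p` largest colors. -/
theorem IsGenPerm.exists_dvd_epsSum {m n p : ℕ} {w : ℕ → ℕ × ℕ} (hw : IsGenPerm m n w)
    (hp : 1 ≤ p) (hpm : p ≤ m) (hdn : 2 * (pin n w).card + 1 ≤ n)
    (hlow : n = 2 * (pin n w).card + 1 → ∃ x ∈ pin n w, x.1 < m - p) :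
    ∃ v, IsGenPerm m n v ∧ p ∣ epsSum n v ∧ pin n v = pin n w := by
  obtain ⟨q, hqmono, hqP⟩ := exists_prec_enumeration (pin n w)
  obtain ⟨u, humono, huU⟩ := exists_prec_enumeration (freeSymbols m n (pin n w))
  rw [hw.card_freeSymbols] at humono huU
  set d := (pin n w).card with hd
  have hqmem : ∀ i < d, q i ∈ pin n w := fun i hi =>
    hqP ▸ Finset.mem_image_of_mem q (Finset.mem_range.mpr hi)
  have humem : ∀ i < n - d, u i ∈ freeSymbols m n (pin n w) := fun i hi =>
    huU ▸ Finset.mem_image_of_mem u (Finset.mem_range.mpr hi)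
  have hqinj : ∀ i < d, ∀ j < d, q i = q j → i = j := by
    intro i hi j hj h
    rcases lt_trichotomy i j with hij | hij | hij
    · exact absurd h (hqmono i j hij hj).ne
    · exact hij
    · exact absurd h.symm (hqmono j i hij hi).ne
  have huq : ∀ i < d, Prec (u (i + 1)) (q i) := by
    intro i hi
    by_contra hnot
    let S := (pinPos n w).filter (fun j => w j = q i ∨ Prec (w j) (q i))
    have hsub : (Finset.range (i + 1)).image q ⊆ S.image w := by
      intro x hx
      obtain ⟨k, hk, rfl⟩ := Finset.mem_image.mp hx
      rw [Finset.mem_range] at hk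
      obtain ⟨j, hj, hjk⟩ := Finset.mem_image.mp (hqmem k (by omega))
      refine Finset.mem_image.mpr ⟨j, Finset.mem_filter.mpr ⟨hj, ?_⟩, hjk⟩
      rw [hjk]
      rcases (Nat.lt_succ_iff.mp hk).eq_or_lt with rfl | h
      · exact Or.inl rfl
      · exact Or.inr (hqmono k i h hi)
    have hScard : i + 1 ≤ S.card := by
      calc i + 1 = ((Finset.range (i + 1)).image q).card := by
            rw [Finset.card_image_of_injOn, Finset.card_range]
            intro a ha b hb hab
            simp only [Finset.coe_range, Set.mem_Iio] at ha hb
            exact hqinj a (by omega) b (by omega) hab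
        _ ≤ (S.image w).card := Finset.card_le_card hsub
        _ ≤ S.card := Finset.card_image_le
    have hlt := hw.card_lt_card_free_below (t := q i) (S := S)
      (Finset.card_pos.mp (by omega)) (Finset.filter_subset _ _)
      (fun j hj => (Finset.mem_filter.mp hj).2)
    have hle : ((freeSymbols m n (pin n w)).filter (fun x => Prec x (q i))).card ≤ i + 1 := by
      calc _ ≤ ((Finset.range (i + 1)).image u).card := by
            refine Finset.card_le_card fun x hx => ?_
            obtain ⟨hx, hxq⟩ := Finset.mem_filter.mp hx
            rw [← huU] at hx
            obtain ⟨k, hk, rfl⟩ := Finset.mem_image.mp hx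
            refine Finset.mem_image_of_mem u (Finset.mem_range.mpr ?_)
            by_contra hki
            rcases (not_lt.mp hki).eq_or_lt with h | h
            · exact hnot (h ▸ hxq)
            · exact hnot ((humono _ k h (Finset.mem_range.mp hk)).trans hxq)
        _ ≤ (Finset.range (i + 1)).card := Finset.card_image_le
        _ = i + 1 := Finset.card_range _
    omega
  obtain ⟨c, hc1, hc2, hc3⟩ := exists_color_dvd_add hp hpm (epsSum n (zigzag n d 0 q u))
  have hucol : ∀ i < n - d, (u i).1 = m - 1 := fun i hi => (mem_freeSymbols.mp (humem i hi)).1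
  refine ⟨zigzag n d c q u, isGenPerm_zigzag hdn hc2 ?_ ?_ ?_ ?_ ?_, ?_, ?_⟩
  · exact fun i hi => hw.bounds_of_mem_pin (hqmem i hi)
  · intro i hi
    exact ⟨by rw [hucol i hi]; omega, (mem_freeSymbols.mp (humem i hi)).2.1⟩
  · exact fun i hi j hj h => hqinj i hi j hj (hw.injOn_norm_pin (hqmem i hi) (hqmem j hj) h)
  · intro i hi j hj h
    have hcol := (hucol i hi).trans (hucol j hj).symm
    rcases lt_trichotomy i j with hij | hij | hij
    · exact absurd (Prod.ext hcol h) (humono i j hij hj).ne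
    · exact hij
    · exact absurd (Prod.ext hcol h).symm (humono j i hij hi).ne
  · exact fun i hi j hj => (mem_freeSymbols.mp (humem j hj)).2.2 _ (hqmem i hi)
  · rw [epsSum_zigzag (by omega)]
    exact hc3
  · rw [pin_zigzag hdn hc2 hucol humono huq, hqP]
    intro hn i hi
    obtain ⟨x, hx, hxm⟩ := hlow hn
    rw [← hqP] at hx
    obtain ⟨k, hk, rfl⟩ := Finset.mem_image.mp hx
    rw [Finset.mem_range] at hk
    left
    rcases (show k ≤ i by omega).eq_or_lt with rfl | h
    · simp only; omega
    · have := hqmono k i h (by omega)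
      unfold Prec at this
      simp only
      omega

theorem prec_shift_iff (k : ℕ) (a b : ℕ × ℕ) :
    Prec (a.1 + k, a.2) (b.1 + k, b.2) ↔ Prec a b := by
  unfold Prec; simp only; omega

theorem pin_psiWord (k n : ℕ) (w : ℕ → ℕ × ℕ) :
    pin n (psiWord k w) = PsiSet k (pin n w) := by
  simp only [pin, PsiSet, psiWord, prec_shift_iff, Finset.image_image]
  rfl

theorem epsSum_psiWord (k n : ℕ) (w : ℕ → ℕ × ℕ) :
    epsSum n (psiWord k w) = epsSum n w + n * k := by
  simp [epsSum, psiWord, Finset.sum_add_distrib]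

theorem IsGenPerm.psiWord {m n : ℕ} {w : ℕ → ℕ × ℕ} (hw : IsGenPerm m n w) (k : ℕ) :
    IsGenPerm (m + k) n (psiWord k w) :=
  ⟨fun i hi => ⟨Nat.add_lt_add_right (hw.1 i hi).1 k, (hw.1 i hi).2⟩, hw.2⟩

theorem psiSet_injective (k : ℕ) : Function.Injective (PsiSet k) := by
  refine Finset.image_injective fun a b h => ?_
  have := Prod.mk.inj h
  exact Prod.ext (by omega) this.2

theorem card_psiSet (k : ℕ) (P : Finset (ℕ × ℕ)) : (PsiSet k P).card = P.card := by
  refine Finset.card_image_of_injective _ fun a b h => ?_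
  have := Prod.mk.inj h
  exact Prod.ext (by omega) this.2

theorem pin_congr {n : ℕ} {v w : ℕ → ℕ × ℕ} (h : ∀ i, 1 ≤ i → i ≤ n → v i = w i) :
    pin n v = pin n w := by
  have hpos : pinPos n v = pinPos n w := by
    ext j
    rw [mem_pinPos, mem_pinPos]
    refine and_congr_right fun hj => ?_
    rw [h (j - 1) (by omega) (by omega), h j (by omega) (by omega),
      h (j + 1) (by omega) (by omega)]
  rw [pin_eq_image_pinPos, pin_eq_image_pinPos, hpos]
  refine Finset.image_congr fun j hj => ?_
  have := (mem_pinPos.mp hj).1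
  exact h j (by omega) (by omega)

theorem epsSum_congr {n : ℕ} {v w : ℕ → ℕ × ℕ} (h : ∀ i, 1 ≤ i → i ≤ n → v i = w i) :
    epsSum n v = epsSum n w :=
  Finset.sum_congr rfl fun i hi => by
    rw [h i (Finset.mem_Icc.mp hi).1 (Finset.mem_Icc.mp hi).2]

/-- If a word of length `2r + 1` has `r` pinnacles, all entries lie weakly below a pinnacle. -/
theorem exists_pinnacle_above {r j : ℕ} {w : ℕ → ℕ × ℕ}
    (hcard : (pinPos (2 * r + 1) w).card = r) (hr : 1 ≤ r) (h1 : 1 ≤ j) (hj : j ≤ 2 * r + 1) :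
    ∃ i ∈ pinPos (2 * r + 1) w, w j = w i ∨ Prec (w j) (w i) := by
  set S := pinPos (2 * r + 1) w with hS
  have hbd : ∀ i ∈ S, 2 ≤ i ∧ i ≤ 2 * r := fun i hi => (mem_pinPos.mp hi).1
  by_cases hj1 : j = 1
  · have hdisj : Disjoint S (S.image (· - 1)) := by
      refine Finset.disjoint_left.mpr fun i hi hi' => ?_
      obtain ⟨s, hs, rfl⟩ := Finset.mem_image.mp hi'
      exact pred_notMem_pinPos hs hi
    have hU : S ∪ S.image (· - 1) = Finset.Icc 1 (2 * r) := by
      refine Finset.eq_of_subset_of_card_le ?_ ?_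
      · intro i hi
        rw [Finset.mem_Icc]
        rcases Finset.mem_union.mp hi with hi | hi
        · have := hbd i hi; omega
        · obtain ⟨s, hs, rfl⟩ := Finset.mem_image.mp hi
          have := hbd s hs
          omega
      · rw [Finset.card_union_of_disjoint hdisj, Finset.card_image_of_injOn, Nat.card_Icc]
        · omega
        · intro a ha b hb hab
          have := hbd a ha
          have := hbd b hb
          simp only at hab
          omega
    have hmem : j ∈ S ∪ S.image (· - 1) := by
      rw [hU, Finset.mem_Icc]; omega
    rcases Finset.mem_union.mp hmem with h | h
    · exact ⟨j, h, Or.inl rfl⟩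
    · obtain ⟨s, hs, rfl⟩ := Finset.mem_image.mp h
      exact ⟨s, hs, Or.inr (mem_pinPos.mp hs).2.1⟩
  · have hdisj : Disjoint S (S.image (· + 1)) := by
      refine Finset.disjoint_left.mpr fun i hi hi' => ?_
      obtain ⟨s, hs, rfl⟩ := Finset.mem_image.mp hi'
      exact succ_notMem_pinPos hs hi
    have hU : S ∪ S.image (· + 1) = Finset.Icc 2 (2 * r + 1) := by
      refine Finset.eq_of_subset_of_card_le ?_ ?_
      · intro i hi
        rw [Finset.mem_Icc]
        rcases Finset.mem_union.mp hi with hi | hi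
        · have := hbd i hi; omega
        · obtain ⟨s, hs, rfl⟩ := Finset.mem_image.mp hi
          have := hbd s hs
          omega
      · rw [Finset.card_union_of_disjoint hdisj,
          Finset.card_image_of_injective _ (add_left_injective 1), Nat.card_Icc]
        omega
    have hmem : j ∈ S ∪ S.image (· + 1) := by
      rw [hU, Finset.mem_Icc]; omega
    rcases Finset.mem_union.mp hmem with h | h
    · exact ⟨j, h, Or.inl rfl⟩
    · obtain ⟨s, hs, rfl⟩ := Finset.mem_image.mp h
      exact ⟨s, hs, Or.inr (mem_pinPos.mp hs).2.2⟩

/-- A word with the maximal number of pinnacles, all of color at least `k`, is a shift by `k`. -/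
theorem IsGenPerm.exists_unshift {p k r : ℕ} {w : ℕ → ℕ × ℕ}
    (hw : IsGenPerm (p + k) (2 * r + 1) w) (hr : 1 ≤ r)
    (hcard : (pin (2 * r + 1) w).card = r) (hcol : ∀ x ∈ pin (2 * r + 1) w, k ≤ x.1) :
    ∃ v, IsGenPerm p (2 * r + 1) v ∧ PsiSet k (pin (2 * r + 1) v) = pin (2 * r + 1) w ∧
      epsSum (2 * r + 1) w = epsSum (2 * r + 1) v + (2 * r + 1) * k := by
  have hk : ∀ j, 1 ≤ j → j ≤ 2 * r + 1 → k ≤ (w j).1 := by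
    intro j h1 hj
    obtain ⟨i, hi, h⟩ := exists_pinnacle_above (hw.card_pinPos.trans hcard) hr h1 hj
    have hi := hcol _ (Finset.mem_image_of_mem w hi)
    rcases h with h | h
    · rwa [h]
    · unfold Prec at h; omega
  let v : ℕ → ℕ × ℕ := fun i => ((w i).1 - k, (w i).2)
  have hv : ∀ j, 1 ≤ j → j ≤ 2 * r + 1 → _root_.psiWord k v j = w j := by
    intro j h1 hj
    have := hk j h1 hj
    exact Prod.ext (Nat.sub_add_cancel this) rfl
  refine ⟨v, ⟨fun i hi => ⟨?_, (hw.1 i hi).2⟩, hw.2⟩, ?_, ?_⟩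
  · have h1 := (hw.1 i hi).1
    rw [Finset.mem_Icc] at hi
    have h2 := hk i hi.1 hi.2
    simp only [v]; omega
  · rw [← pin_psiWord, pin_congr hv]
  · rw [← epsSum_psiWord, epsSum_congr hv]

/-- `Ψ_{m-p}(APS(p,2r+1) ∖ APS(p,p,2r+1)) = APS(m,2r+1) ∖ APS(m,p,2r+1)`. -/
theorem complement_bijection (m p r : ℕ) (hm : 1 ≤ m) (hp : 1 ≤ p) (hr : 1 ≤ r)
    (hpm : p ∣ m) :
    PsiSet (m - p) '' (APS p (2 * r + 1) r \ APSc p p (2 * r + 1) r) =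
      APS m (2 * r + 1) r \ APSc m p (2 * r + 1) r := by
  have hle : p ≤ m := Nat.le_of_dvd hm hpm
  obtain ⟨k, rfl⟩ : ∃ k, m = p + k := ⟨m - p, by omega⟩
  have hpk : p ∣ k := (Nat.dvd_add_right (dvd_refl p)).mp hpm
  rw [Nat.add_sub_cancel_left]
  ext Q
  constructor
  · rintro ⟨P, ⟨⟨⟨w, hw, rfl⟩, hcard⟩, hnot⟩, rfl⟩
    have hr' : (pin (2 * r + 1) w).card = r := by
      by_contra hne
      exact hnot ⟨hw.exists_dvd_epsSum hp le_rfl (by omega) (by omega), hcard⟩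
    refine ⟨⟨⟨_, hw.psiWord k, pin_psiWord _ _ _⟩, (card_psiSet _ _).trans_le hcard⟩, ?_⟩
    rintro ⟨⟨v, hv, hdvd, hpin⟩, -⟩
    obtain ⟨v', hv', hpin', hsum⟩ := hv.exists_unshift hr
      (by rw [hpin, card_psiSet, hr']) (by
        rw [hpin]
        intro x hx
        obtain ⟨y, -, rfl⟩ := Finset.mem_image.mp hx
        exact Nat.le_add_left _ _)
    refine hnot ⟨⟨v', hv', ?_, psiSet_injective k (hpin'.trans hpin)⟩, hcard⟩
    rw [hsum] at hdvd
    exact (Nat.dvd_add_left (hpk.mul_left _)).mp hdvd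
  · rintro ⟨⟨⟨w, hw, rfl⟩, hcard⟩, hnot⟩
    have hmax : (pin (2 * r + 1) w).card = r ∧ ∀ x ∈ pin (2 * r + 1) w, k ≤ x.1 := by
      by_contra hne
      refine hnot ⟨hw.exists_dvd_epsSum hp hle (by omega) fun h => ?_, hcard⟩
      by_contra hx
      push Not at hx
      exact hne ⟨by omega, fun x hx' => by have := hx x hx'; omega⟩
    obtain ⟨v, hv, hpin, -⟩ := hw.exists_unshift hr hmax.1 hmax.2
    have hvcard : (pin (2 * r + 1) v).card ≤ r := by
      rw [← card_psiSet k, hpin]; exact hcard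
    refine ⟨_, ⟨⟨⟨v, hv, rfl⟩, hvcard⟩, ?_⟩, hpin⟩
    rintro ⟨⟨v', hv', hdvd, hpin'⟩, -⟩
    refine hnot ⟨⟨_, hv'.psiWord k, ?_, ?_⟩, hcard⟩
    · rw [epsSum_psiWord]
      exact dvd_add hdvd (hpk.mul_left _)
    · rw [pin_psiWord, hpin', hpin]
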